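/- Suppose the decision space U is finite and that (Ω, ℬ, P, T) is a conditional K-automorphism relative to 𝒴_{−∞,0}. Then every mean-optimal strategy ũ is pathwise optimal: for every admissible strategy u, liminf_{T→∞} (L_T(u) − L_T(ũ)) ≥ 0 almost surely. -/

import Mathlib

open MeasureTheory Filter Set
open scoped ENNReal Topology symmDiff

noncomputable section

namespace ErgodicDecisions

variable {Ω U : Type*}

/-- The `ℤ`-indexed iterates of an invertible transformation `T` with inverse `S`:
`iter T S n = Tⁿ` for `n ≥ 0` and `iter T S (-n) = Sⁿ`. -/
def iter (T S : Ω → Ω) : ℤ → Ω → Ω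
  | Int.ofNat n => T^[n]
  | Int.negSucc n => S^[n + 1]

variable {m0 : MeasurableSpace Ω} [mU : MeasurableSpace U]

/-- The observation σ-field `𝒴_{m,n} = ⋁_{k=m}^{n} T^{-k} 𝒴`. -/
def obsField (T S : Ω → Ω) (Y : MeasurableSpace Ω) (m n : ℤ) : MeasurableSpace Ω :=
  ⨆ k ∈ Set.Icc m n, MeasurableSpace.comap (iter T S k) Y

/-- The observation σ-field `𝒴_{-∞,n} = ⋁_{k ≤ n} T^{-k} 𝒴`. -/
def obsFieldLE (T S : Ω → Ω) (Y : MeasurableSpace Ω) (n : ℤ) : MeasurableSpace Ω :=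
  ⨆ k ∈ Set.Iic n, MeasurableSpace.comap (iter T S k) Y

/-- `𝕌_{m,n}`: the set of `𝒴_{m,n}`-measurable decision maps `Ω → U`. -/
def Umn (T S : Ω → Ω) (Y : MeasurableSpace Ω) (m n : ℤ) : Set (Ω → U) :=
  {v | Measurable[obsField T S Y m n] v}

/-- `𝕌_n = ⋃_{m ≤ n} 𝕌_{m,n}`. -/
def Un (T S : Ω → Ω) (Y : MeasurableSpace Ω) (n : ℤ) : Set (Ω → U) :=
  ⋃ m ∈ Set.Iic n, Umn T S Y m n

/-- The loss at time `n` of the decision map `v`: `ℓ_n(v)(ω) = ℓ(v(ω), Tⁿω)`. -/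
def lossAt (T S : Ω → Ω) (ℓ : U → Ω → ℝ) (n : ℤ) (v : Ω → U) (ω : Ω) : ℝ :=
  ℓ (v ω) (iter T S n ω)

/-- An admissible strategy: `u_k` is `𝒴_{0,k}`-measurable for every `k ≥ 1`. -/
def Admissible (T S : Ω → Ω) (Y : MeasurableSpace Ω) (u : ℕ → Ω → U) : Prop :=
  ∀ k : ℕ, 1 ≤ k → u k ∈ Umn T S Y 0 (k : ℤ)

/-- The time-average loss `L_T(u) = T⁻¹ ∑_{k=1}^T ℓ_k(u_k)`. -/
def avgLoss (T S : Ω → Ω) (ℓ : U → Ω → ℝ) (u : ℕ → Ω → U) (n : ℕ) (ω : Ω) : ℝ :=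
  (n : ℝ)⁻¹ * ∑ k ∈ Finset.Icc 1 n, lossAt T S ℓ (k : ℤ) (u k) ω

/-- `g` is an essential infimum (an a.e.-greatest lower bound among random variables)
of the family `(f i)_{i ∈ S₀}` under `P`. -/
def IsEssInfFam {ι : Type*} (P : Measure Ω) (S₀ : Set ι) (f : ι → Ω → ℝ) (g : Ω → ℝ) : Prop :=
  Measurable[m0] g ∧ (∀ i ∈ S₀, ∀ᵐ ω ∂P, g ω ≤ f i ω) ∧
    ∀ h : Ω → ℝ, Measurable[m0] h → (∀ i ∈ S₀, ∀ᵐ ω ∂P, h ω ≤ f i ω) → ∀ᵐ ω ∂P, h ω ≤ g ω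

/-- `g` is an essential supremum (an a.e.-least upper bound among random variables)
of the family `(f i)_{i ∈ S₀}` under `P`. -/
def IsEssSupFam {ι : Type*} (P : Measure Ω) (S₀ : Set ι) (f : ι → Ω → ℝ) (g : Ω → ℝ) : Prop :=
  Measurable[m0] g ∧ (∀ i ∈ S₀, ∀ᵐ ω ∂P, f i ω ≤ g ω) ∧
    ∀ h : Ω → ℝ, Measurable[m0] h → (∀ i ∈ S₀, ∀ᵐ ω ∂P, f i ω ≤ h ω) → ∀ᵐ ω ∂P, g ω ≤ h ω

/-- A mean-optimal strategy in the sense of Lemma 2.5 of the paper: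
`E[ℓ_k(ũ_k)|𝒴_{0,k}] ≤ ess inf_{u ∈ 𝕌_{0,k}} E[ℓ_k(u)|𝒴_{0,k}] + 1/k` a.s. for all `k ≥ 1`. -/
def MeanOptimalStrategy (P : Measure Ω) (T S : Ω → Ω) (Y : MeasurableSpace Ω)
    (ℓ : U → Ω → ℝ) (ut : ℕ → Ω → U) : Prop :=
  Admissible T S Y ut ∧
    ∀ k : ℕ, 1 ≤ k → ∃ g : Ω → ℝ,
      IsEssInfFam P (Umn T S Y 0 (k : ℤ))
        (fun v => P[lossAt T S ℓ (k : ℤ) v | obsField T S Y 0 (k : ℤ)]) g ∧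
      ∀ᵐ ω ∂P, (P[lossAt T S ℓ (k : ℤ) (ut k) | obsField T S Y 0 (k : ℤ)]) ω ≤ g ω + (k : ℝ)⁻¹

/-- Pathwise optimality (Definition 2.2). -/
def PathwiseOptimal (P : Measure Ω) (T S : Ω → Ω) (Y : MeasurableSpace Ω)
    (ℓ : U → Ω → ℝ) (us : ℕ → Ω → U) : Prop :=
  Admissible T S Y us ∧
    ∀ u : ℕ → Ω → U, Admissible T S Y u →
      ∀ᵐ ω ∂P,
        0 ≤ Filter.liminf (fun n : ℕ => avgLoss T S ℓ u n ω - avgLoss T S ℓ us n ω) atTop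

/-- Weak pathwise optimality (Definition 2.3). -/
def WeaklyPathwiseOptimal (P : Measure Ω) (T S : Ω → Ω) (Y : MeasurableSpace Ω)
    (ℓ : U → Ω → ℝ) (us : ℕ → Ω → U) : Prop :=
  Admissible T S Y us ∧
    ∀ u : ℕ → Ω → U, Admissible T S Y u → ∀ ε : ℝ, 0 < ε →
      Tendsto (fun n : ℕ => P {ω | -ε ≤ avgLoss T S ℓ u n ω - avgLoss T S ℓ us n ω})
        atTop (𝓝 1)

/-- Mean optimality (Definition 2.4). -/
def MeanOptimal (P : Measure Ω) (T S : Ω → Ω) (Y : MeasurableSpace Ω)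
    (ℓ : U → Ω → ℝ) (us : ℕ → Ω → U) : Prop :=
  Admissible T S Y us ∧
    ∀ u : ℕ → Ω → U, Admissible T S Y u →
      0 ≤ Filter.liminf
        (fun n : ℕ => (∫ ω, avgLoss T S ℓ u n ω ∂P) - ∫ ω, avgLoss T S ℓ us n ω ∂P) atTop

/-- Two σ-fields on `Ω` agree modulo `P`-null sets. -/
def EqModP (P : Measure Ω) (m₁ m₂ : MeasurableSpace Ω) : Prop :=
  (∀ A : Set Ω, MeasurableSet[m₁] A → ∃ B : Set Ω, MeasurableSet[m₂] B ∧ P (A ∆ B) = 0) ∧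
    ∀ A : Set Ω, MeasurableSet[m₂] A → ∃ B : Set Ω, MeasurableSet[m₁] B ∧ P (A ∆ B) = 0

/-- Conditional K-automorphism relative to `Z` (Definition 1.4); `S` is the inverse of `T`,
so that `T^{-k}𝒳 = comap T^k 𝒳` and `T^{k}𝒳 = comap S^k 𝒳`. -/
def CondK (P : Measure Ω) (T S : Ω → Ω) (Z : MeasurableSpace Ω) : Prop :=
  ∃ X : MeasurableSpace Ω, X ≤ m0 ∧
    X ≤ MeasurableSpace.comap T X ∧
    EqModP P (⨆ k : ℕ, MeasurableSpace.comap (T^[k + 1]) X) m0 ∧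
    EqModP P (⨅ k : ℕ, Z ⊔ MeasurableSpace.comap (S^[k + 1]) X) Z

/-- Conditional weak mixing relative to `Z` (Definition 1.3); `S` is the inverse of `T`,
so that `T^k B = (S^[k])⁻¹ B`. -/
def CondWeakMixing (P : Measure Ω) (S : Ω → Ω) (Z : MeasurableSpace Ω) : Prop :=
  ∀ A B : Set Ω, MeasurableSet[m0] A → MeasurableSet[m0] B →
    Tendsto
      (fun n : ℕ => ∫ ω,
        (n : ℝ)⁻¹ * ∑ k ∈ Finset.Icc 1 n,
          |(P[(A ∩ S^[k] ⁻¹' B).indicator (fun _ => (1 : ℝ)) | Z]) ω -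
            (P[A.indicator (fun _ => (1 : ℝ)) | Z]) ω *
              (P[(S^[k] ⁻¹' B).indicator (fun _ => (1 : ℝ)) | Z]) ω| ∂P)
      atTop (𝓝 0)

/-- The tail σ-field `⋂_{k≥1} (𝒴_{-∞,0} ∨ T^k 𝒳)`. -/
def tailField (T S : Ω → Ω) (Y X : MeasurableSpace Ω) : MeasurableSpace Ω :=
  ⨅ k : ℕ, obsFieldLE T S Y 0 ⊔ MeasurableSpace.comap (S^[k + 1]) X

/-- The truncated loss `ℓ_0(v)·1_{Λ ≤ M}`. -/
def truncLoss (ℓ : U → Ω → ℝ) (Λ : Ω → ℝ) (M : ℝ) (v : Ω → U) (ω : Ω) : ℝ :=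
  if Λ ω ≤ M then ℓ (v ω) ω else 0

/-- `ℓ̄_0^M(v) = ℓ_0(v)·1_{Λ≤M} − E[ℓ_0(v)·1_{Λ≤M} | 𝒴_{-∞,0}]`. -/
def barLoss (P : Measure Ω) (T S : Ω → Ω) (Y : MeasurableSpace Ω)
    (ℓ : U → Ω → ℝ) (Λ : Ω → ℝ) (M : ℝ) (v : Ω → U) (ω : Ω) : ℝ :=
  truncLoss ℓ Λ M v ω - (P[truncLoss ℓ Λ M v | obsFieldLE T S Y 0]) ω

/-- The uniform conditional mixing assumption of Theorem 2.12:
`lim_{M→∞} limsup_{T→∞} E[(1/T)∑_{k=1}^T ess sup_{u,u'∈𝕌₀}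
|E[(ℓ̄₀^M(u)∘T^{-k})·ℓ̄₀^M(u')|𝒴_{-∞,0}]|] = 0`. -/
def UniformCondMixing (P : Measure Ω) (T S : Ω → Ω) (Y : MeasurableSpace Ω)
    (ℓ : U → Ω → ℝ) (Λ : Ω → ℝ) : Prop :=
  ∃ G : ℝ → ℕ → Ω → ℝ,
    (∀ (M : ℝ) (k : ℕ),
      IsEssSupFam P ((Un T S Y 0) ×ˢ (Un T S Y 0))
        (fun p ω =>
          |(P[(fun ω' => barLoss P T S Y ℓ Λ M p.1 (S^[k] ω') *
                barLoss P T S Y ℓ Λ M p.2 ω') | obsFieldLE T S Y 0]) ω|)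
        (G M k)) ∧
    Tendsto
      (fun M : ℝ =>
        Filter.limsup
          (fun n : ℕ => ∫ ω, (n : ℝ)⁻¹ * ∑ k ∈ Finset.Icc 1 n, G M k ω ∂P) atTop)
      atTop (𝓝 0)

/-- Equimeasurability of the loss (Definition 3.1): for every `ε > 0` there is a set of
probability at least `1-ε` on which the family `{ℓ(u,·) : u ∈ U}` is totally bounded
in `L^∞(P)`. -/
def Equimeasurable (P : Measure Ω) (ℓ : U → Ω → ℝ) : Prop :=
  ∀ ε : ℝ, 0 < ε → ∃ Ωε : Set Ω, MeasurableSet[m0] Ωε ∧ 1 - ENNReal.ofReal ε ≤ P Ωε ∧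
    ∀ δ : ℝ, 0 < δ → ∃ 𝒩 : Finset (Ω → ℝ), ∀ u : U, ∃ f ∈ 𝒩,
      eLpNorm (fun ω => Ωε.indicator (ℓ u) ω - f ω) ⊤ P ≤ ENNReal.ofReal δ


/-- Maximal function of partial sums. -/
noncomputable def maxSum {Ω : Type*} (T : Ω → Ω) (F : Ω → ℝ) : ℕ → Ω → ℝ
  | 0 => fun _ => 0
  | n + 1 => fun ω => max 0 (F ω + maxSum T F n (T ω))

section
variable {Ω : Type*} {m0 : MeasurableSpace Ω} {P : Measure Ω} [IsProbabilityMeasure P] {T : Ω → Ω}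

lemma maxSum_nonneg (F : Ω → ℝ) (n : ℕ) (ω : Ω) : 0 ≤ maxSum T F n ω := by
  cases n <;> simp [maxSum]

lemma maxSum_mono (F : Ω → ℝ) (n : ℕ) (ω : Ω) : maxSum T F n ω ≤ maxSum T F (n+1) ω := by
  induction n generalizing ω with
  | zero => exact maxSum_nonneg _ _ _
  | succ n ih =>
    have := ih (T ω)
    change max 0 (F ω + maxSum T F n (T ω)) ≤ max 0 (F ω + maxSum T F (n+1) (T ω))
    exact max_le_max le_rfl (by linarith)

lemma sum_le_maxSum (F : Ω → ℝ) (n : ℕ) (ω : Ω) :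
    ∑ k ∈ Finset.range n, F (T^[k] ω) ≤ maxSum T F n ω := by
  induction n generalizing ω with
  | zero => simp [maxSum]
  | succ n ih =>
    rw [Finset.sum_range_succ', maxSum]
    have := ih (T ω)
    simp only [Function.iterate_succ, Function.comp_apply, Function.iterate_zero, id]
    exact le_max_of_le_right (by linarith)

lemma maxSum_measurable (hT : Measurable T) {F : Ω → ℝ} (hF : Measurable F) (n : ℕ) :
    Measurable (maxSum T F n) := by
  induction n with
  | zero => exact measurable_const
  | succ n ih => exact measurable_const.max (hF.add (ih.comp hT))

lemma maxSum_integrable (hT : MeasurePreserving T P P) {F : Ω → ℝ} (hF : Integrable F P) (n : ℕ) :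
    Integrable (maxSum T F n) P := by
  induction n with
  | zero => exact integrable_const 0
  | succ n ih =>
    exact (integrable_const (0:ℝ)).sup (hF.add (hT.integrable_comp_of_integrable ih))

lemma maximal_aux (hT : MeasurePreserving T P P) {F : Ω → ℝ} (hFm : Measurable F)
    (hF : Integrable F P) (n : ℕ) :
    0 ≤ ∫ ω in {ω | 0 < maxSum T F n ω}, F ω ∂P := by
  set A := {ω | 0 < maxSum T F n ω} with hA
  have hAm : MeasurableSet A := measurableSet_lt measurable_const (maxSum_measurable hT.measurable hFm n)
  have hi := maxSum_integrable hT hF n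
  have hi' : Integrable (fun ω => maxSum T F n (T ω)) P := hT.integrable_comp_of_integrable hi
  have e1 : ∫ ω, maxSum T F n (T ω) ∂P = ∫ ω, maxSum T F n ω ∂P := by
    have := integral_map (μ := P) hT.measurable.aemeasurable (f := maxSum T F n)
      (by rw [hT.map_eq]; exact hi.aestronglyMeasurable)
    rw [hT.map_eq] at this
    exact this.symm
  have e2 : ∫ ω in A, maxSum T F n ω ∂P = ∫ ω, maxSum T F n ω ∂P := by
    rw [← integral_indicator hAm]
    congr 1; ext ω
    by_cases h : ω ∈ A
    · simp [h]
    · rw [Set.indicator_of_notMem h]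
      exact le_antisymm (maxSum_nonneg _ _ _) (not_lt.mp h)
  have e3 : ∫ ω in A, maxSum T F n (T ω) ∂P ≤ ∫ ω, maxSum T F n (T ω) ∂P :=
    setIntegral_le_integral hi' (ae_of_all _ fun ω => maxSum_nonneg _ _ _)
  have e4 : ∫ ω in A, (maxSum T F n ω - maxSum T F n (T ω)) ∂P ≤ ∫ ω in A, F ω ∂P := by
    refine setIntegral_mono_on (hi.sub hi').integrableOn hF.integrableOn hAm fun ω hω => ?_
    have h1 : 0 < maxSum T F n ω := hω
    have h2 := maxSum_mono (T := T) F n ω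
    have h3 : 0 < maxSum T F (n+1) ω := h1.trans_le h2
    change _ ≤ max 0 (F ω + maxSum T F n (T ω)) at h2
    change 0 < max 0 (F ω + maxSum T F n (T ω)) at h3
    rcases le_or_gt (F ω + maxSum T F n (T ω)) 0 with h | h
    · rw [max_eq_left h] at h3; exact absurd h3 (lt_irrefl _)
    · rw [max_eq_right h.le] at h2; linarith
  rw [integral_sub hi.integrableOn hi'.integrableOn] at e4
  linarith

/-- Weak-type maximal ergodic inequality. -/
lemma maximal_ineq (hT : MeasurePreserving T P P) {h : Ω → ℝ} (hm : Measurable h)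
    (hi : Integrable h P) (h0 : ∀ ω, 0 ≤ h ω) {c : ℝ} (hc : 0 < c) :
    P {ω | ∃ n : ℕ, n * c < ∑ k ∈ Finset.range n, h (T^[k] ω)} ≤
      ENNReal.ofReal ((∫ ω, h ω ∂P) / c) := by
  set F : Ω → ℝ := fun ω => h ω - c
  have hFm : Measurable F := hm.sub measurable_const
  have hFi : Integrable F P := hi.sub (integrable_const c)
  have hsub : {ω | ∃ n : ℕ, n * c < ∑ k ∈ Finset.range n, h (T^[k] ω)} ⊆
      ⋃ n, {ω | 0 < maxSum T F n ω} := by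
    rintro ω ⟨n, hn⟩
    refine mem_iUnion.2 ⟨n, ?_⟩
    refine lt_of_lt_of_le ?_ (sum_le_maxSum F n ω)
    simp only [F, Finset.sum_sub_distrib, Finset.sum_const, Finset.card_range, nsmul_eq_mul]
    linarith
  refine (measure_mono hsub).trans ?_
  have hmono : Monotone fun n => {ω | 0 < maxSum T F n ω} :=
    monotone_nat_of_le_succ fun n ω hω => lt_of_lt_of_le hω (maxSum_mono F n ω)
  rw [hmono.measure_iUnion]
  refine iSup_le fun n => ?_
  have h1 := maximal_aux hT hFm hFi n
  set A := {ω | 0 < maxSum T F n ω}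
  rw [integral_sub hi.integrableOn (integrable_const c).integrableOn, setIntegral_const] at h1
  have h2 : ∫ ω in A, h ω ∂P ≤ ∫ ω, h ω ∂P :=
    setIntegral_le_integral hi (ae_of_all _ h0)
  rw [← ENNReal.ofReal_toReal (measure_ne_top P A)]
  apply ENNReal.ofReal_le_ofReal
  rw [le_div_iff₀ hc]
  simp only [smul_eq_mul, Measure.real] at h1
  linarith

/-- Cesàro convergence to zero. -/
def Ces (a : ℕ → ℝ) : Prop :=
  Tendsto (fun n : ℕ => (n : ℝ)⁻¹ * ∑ k ∈ Finset.Icc 1 n, a k) atTop (𝓝 0)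

lemma Ces.add {a b : ℕ → ℝ} (ha : Ces a) (hb : Ces b) : Ces (fun k => a k + b k) := by
  have := Tendsto.add ha hb
  simpa [Ces, Finset.sum_add_distrib, mul_add] using this

lemma Ces.sum {ι : Type*} (s : Finset ι) {a : ι → ℕ → ℝ} (ha : ∀ i ∈ s, Ces (a i)) :
    Ces (fun k => ∑ i ∈ s, a i k) := by
  have := tendsto_finsetSum s ha
  simp only [Finset.sum_const_zero] at this
  refine this.congr fun n => ?_
  rw [← Finset.mul_sum, Finset.sum_comm]

lemma ces_of_tendsto {a : ℕ → ℝ} (ha : Tendsto a atTop (𝓝 0)) : Ces a := by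
  have h1 := (ha.comp (tendsto_add_atTop_nat 1)).cesaro
  refine h1.congr fun n => ?_
  congr 1
  rw [Finset.range_eq_Ico]
  have := Finset.sum_Ico_add' (fun k => a k) 0 n 1
  simp only [zero_add] at this
  exact this

/-- The approximation principle. -/
lemma ces_of_approx (hT : MeasurePreserving T P P) {a : ℕ → Ω → ℝ}
    (H : ∀ ε : ℝ, 0 < ε → ∃ (h : Ω → ℝ) (b : ℕ → Ω → ℝ), Integrable h P ∧
      ∫ ω, |h ω| ∂P ≤ ε ∧ (∀ᵐ ω ∂P, Ces (fun k => b k ω)) ∧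
      ∀ k, 1 ≤ k → ∀ᵐ ω ∂P, |a k ω - b k ω| ≤ |h (T^[k] ω)|) :
    ∀ᵐ ω ∂P, Ces (fun k => a k ω) := by
  have key : ∀ c : ℝ, 0 < c → ∀ᵐ ω ∂P, ∀ᶠ n : ℕ in atTop,
      |(n : ℝ)⁻¹ * ∑ k ∈ Finset.Icc 1 n, a k ω| ≤ 2 * c := by
    intro c hc
    rw [ae_iff]
    refine le_antisymm (ENNReal.le_of_forall_pos_le_add fun ε hε _ => ?_) bot_le
    obtain ⟨h, b, hi, hle, hb, hab⟩ := H (c * ε) (by positivity)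
    have hi1 : Integrable (fun ω => |h ω|) P := hi.abs
    set h' : Ω → ℝ := fun ω => |(hi1.aestronglyMeasurable.mk _) ω|
    have hm' : Measurable h' := (hi1.aestronglyMeasurable.stronglyMeasurable_mk.measurable).abs
    have heq : (fun ω => |h ω|) =ᵐ[P] h' := by
      filter_upwards [hi1.aestronglyMeasurable.ae_eq_mk] with ω hω
      simp only [h', ← hω, abs_abs]
    have hi' : Integrable h' P := hi1.congr heq
    have hmi : Integrable (fun ω => h' (T ω)) P := hT.integrable_comp_of_integrable hi'
    have hint : ∫ ω, h' (T ω) ∂P = ∫ ω, h' ω ∂P := by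
      have := integral_map (μ := P) hT.measurable.aemeasurable (f := h')
        (by rw [hT.map_eq]; exact hi'.aestronglyMeasurable)
      rw [hT.map_eq] at this
      exact this.symm
    have hmax := maximal_ineq hT (hm'.comp hT.measurable) hmi (fun ω => abs_nonneg _) hc
    have hbound : ENNReal.ofReal ((∫ ω, (h' ∘ T) ω ∂P) / c) ≤ ε := by
      rw [← ENNReal.ofReal_coe_nnreal]
      apply ENNReal.ofReal_le_ofReal
      rw [div_le_iff₀ hc]
      simp only [Function.comp_apply]
      rw [hint, ← integral_congr_ae heq]
      linarith
    rw [zero_add]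
    refine le_trans ?_ (hmax.trans hbound)
    apply measure_mono_ae
    have heqk : ∀ᵐ ω ∂P, ∀ k, |h (T^[k] ω)| = h' (T^[k] ω) := by
      rw [ae_all_iff]; intro k
      exact (hT.iterate k).quasiMeasurePreserving.ae heq
    have hab' : ∀ᵐ ω ∂P, ∀ k, 1 ≤ k → |a k ω - b k ω| ≤ |h (T^[k] ω)| := by
      rw [ae_all_iff]; intro k
      by_cases hk : 1 ≤ k
      · filter_upwards [hab k hk] with ω hω _ using hω
      · exact ae_of_all _ fun ω h => absurd h hk
    filter_upwards [heqk, hab', hb] with ω h1 h2 h3 h4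
    by_contra hcon
    apply h4
    have hcon' : ∀ n : ℕ, ∑ k ∈ Finset.range n, (h' ∘ T) (T^[k] ω) ≤ n * c := by
      intro n; by_contra hn
      exact hcon ⟨n, not_le.mp hn⟩
    have h5 := (Metric.tendsto_nhds.mp h3) c hc
    filter_upwards [h5, eventually_ge_atTop 1] with n hn hn1
    rw [Real.dist_eq, sub_zero] at hn
    have hnpos : (0:ℝ) < n := by exact_mod_cast hn1
    have h6 : |(n : ℝ)⁻¹ * ∑ k ∈ Finset.Icc 1 n, (a k ω - b k ω)| ≤ c := by
      rw [abs_mul, abs_of_pos (inv_pos.mpr hnpos), inv_mul_le_iff₀ hnpos]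
      refine le_trans (Finset.abs_sum_le_sum_abs _ _) (le_trans ?_ (hcon' n))
      have : ∑ k ∈ Finset.range n, (h' ∘ T) (T^[k] ω) = ∑ k ∈ Finset.Icc 1 n, h' (T^[k] ω) := by
        rw [Finset.range_eq_Ico]
        have := Finset.sum_Ico_add' (fun k => h' (T^[k] ω)) 0 n 1
        simp only [Function.iterate_succ', Function.comp_apply, zero_add] at this ⊢
        exact this
      rw [this]
      refine Finset.sum_le_sum fun k hk => ?_
      rw [← h1 k]
      exact h2 k (Finset.mem_Icc.mp hk).1
    have h7 : (n : ℝ)⁻¹ * ∑ k ∈ Finset.Icc 1 n, a k ω =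
        (n : ℝ)⁻¹ * ∑ k ∈ Finset.Icc 1 n, (a k ω - b k ω) +
        (n : ℝ)⁻¹ * ∑ k ∈ Finset.Icc 1 n, b k ω := by
      rw [Finset.sum_sub_distrib]; ring
    rw [h7]
    refine (abs_add_le _ _).trans ?_
    linarith
  have key2 : ∀ᵐ ω ∂P, ∀ j : ℕ, ∀ᶠ n : ℕ in atTop,
      |(n : ℝ)⁻¹ * ∑ k ∈ Finset.Icc 1 n, a k ω| ≤ 2 * (1 / ((j : ℝ) + 1)) := by
    rw [ae_all_iff]; intro j; exact key _ (by positivity)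
  filter_upwards [key2] with ω hω
  rw [Ces, Metric.tendsto_nhds]
  intro ε hε
  obtain ⟨j, hj⟩ := exists_nat_one_div_lt (show 0 < ε / 2 by positivity)
  filter_upwards [hω j] with n hn
  rw [Real.dist_eq, sub_zero]
  linarith

/-- Maker's theorem, null version. -/
lemma ces_maker (hT : MeasurePreserving T P P) {ψ : ℕ → Ω → ℝ} {D : Ω → ℝ}
    (hψm : ∀ k, Measurable (ψ k)) (hD : Integrable D P) (h0 : ∀ k ω, 0 ≤ ψ k ω)
    (hle : ∀ k ω, ψ k ω ≤ D ω) (hlim : ∀ᵐ ω ∂P, Tendsto (fun k => ψ k ω) atTop (𝓝 0)) :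
    ∀ᵐ ω ∂P, Ces (fun k => ψ k (T^[k] ω)) := by
  apply ces_of_approx hT
  intro ε hε
  set H : ℕ → Ω → ℝ := fun N ω => ⨆ k, ψ (N + k) ω
  have hbdd : ∀ N ω, BddAbove (range fun k => ψ (N + k) ω) := fun N ω =>
    ⟨D ω, by rintro _ ⟨k, rfl⟩; exact hle _ _⟩
  have hH0 : ∀ N ω, 0 ≤ H N ω := fun N ω => (h0 _ ω).trans (le_ciSup (hbdd N ω) 0)
  have hHD : ∀ N ω, H N ω ≤ D ω := fun N ω => ciSup_le fun k => hle _ _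
  have hHm : ∀ N, Measurable (H N) := fun N => Measurable.iSup fun k => hψm _
  have hHlim : ∀ᵐ ω ∂P, Tendsto (fun N => H N ω) atTop (𝓝 0) := by
    filter_upwards [hlim] with ω hω
    rw [Metric.tendsto_atTop] at hω ⊢
    intro δ hδ
    obtain ⟨N, hN⟩ := hω (δ/2) (by positivity)
    refine ⟨N, fun n hn => ?_⟩
    rw [Real.dist_eq, sub_zero, abs_of_nonneg (hH0 _ _)]
    refine lt_of_le_of_lt (ciSup_le fun k => ?_) (half_lt_self hδ)
    have := hN (n + k) (by omega)
    rw [Real.dist_eq, sub_zero] at this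
    exact (le_abs_self _).trans this.le
  have hI : Tendsto (fun N => ∫ ω, H N ω ∂P) atTop (𝓝 (∫ _, (0:ℝ) ∂P)) := by
    refine tendsto_integral_of_dominated_convergence D (fun N => (hHm N).aestronglyMeasurable) hD
      (fun N => ae_of_all _ fun ω => ?_) hHlim
    rw [Real.norm_eq_abs, abs_of_nonneg (hH0 _ _)]; exact hHD _ _
  rw [integral_zero] at hI
  obtain ⟨N, hN⟩ := ((tendsto_order.1 hI).2 ε hε).exists
  refine ⟨H N, fun k ω => if k < N then ψ k (T^[k] ω) else 0, ?_, ?_, ?_, ?_⟩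
  · refine hD.mono' (hHm N).aestronglyMeasurable (ae_of_all _ fun ω => ?_)
    rw [Real.norm_eq_abs, abs_of_nonneg (hH0 _ _)]; exact hHD _ _
  · simp only [abs_of_nonneg (hH0 _ _)]; exact hN.le
  · refine ae_of_all _ fun ω => ces_of_tendsto ?_
    refine tendsto_const_nhds.congr' ?_
    filter_upwards [eventually_ge_atTop N] with k hk
    rw [if_neg (by omega)]
  · intro k _
    refine ae_of_all _ fun ω => ?_
    dsimp only
    split_ifs with hk
    · simp
    · rw [sub_zero, abs_of_nonneg (h0 _ _), abs_of_nonneg (hH0 _ _)]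
      obtain ⟨j, rfl⟩ := Nat.exists_eq_add_of_le (not_lt.mp hk)
      exact le_ciSup (hbdd N (T^[N+j] ω)) j

end

section
variable {Ω : Type*} {m0 : MeasurableSpace Ω} {P : Measure Ω} [IsProbabilityMeasure P] {T : Ω → Ω}

/-- Strong law for bounded orthogonal sequences. -/
lemma ces_of_orthogonal {D : ℕ → Ω → ℝ} {C : ℝ} (hDm : ∀ k, AEStronglyMeasurable (D k) P)
    (hC : ∀ k, ∀ᵐ ω ∂P, |D k ω| ≤ C)
    (horth : ∀ i j, i < j → ∫ ω, D i ω * D j ω ∂P = 0) :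
    ∀ᵐ ω ∂P, Ces (fun k => D k ω) := by
  set s : ℕ → Ω → ℝ := fun n ω => ∑ k ∈ Finset.Icc 1 n, D k ω with hs
  have hC0 : 0 ≤ C := by
    obtain ⟨ω, hω⟩ := (hC 0).exists
    exact (abs_nonneg _).trans hω
  have hD2 : ∀ i j, Integrable (fun ω => D i ω * D j ω) P := fun i j => by
    refine (integrable_const (C * C)).mono' ((hDm i).mul (hDm j)) ?_
    filter_upwards [hC i, hC j] with ω h1 h2
    rw [Real.norm_eq_abs, abs_mul]
    exact mul_le_mul h1 h2 (abs_nonneg _) hC0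
  have hsucc : ∀ n ω, s (n+1) ω = s n ω + D (n+1) ω := fun n ω =>
    Finset.sum_Icc_succ_top (by omega) _
  have hsD : ∀ n j, Integrable (fun ω => s n ω * D j ω) P := fun n j => by
    simp only [hs, Finset.sum_mul]
    exact integrable_finsetSum _ fun i _ => hD2 i j
  have hss : ∀ n, Integrable (fun ω => s n ω ^ 2) P ∧ ∫ ω, s n ω ^ 2 ∂P ≤ n * C ^ 2 := by
    intro n
    induction n with
    | zero => simp [hs]
    | succ n ih =>
      have e : (fun ω => s (n+1) ω ^ 2) = fun ω => (s n ω ^ 2 + 2 * (s n ω * D (n+1) ω))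
          + D (n+1) ω * D (n+1) ω := by
        ext ω; rw [hsucc]; ring
      have i1 := ih.1
      have i2 : Integrable (fun ω => 2 * (s n ω * D (n+1) ω)) P := (hsD n (n+1)).const_mul 2
      have z : ∫ ω, s n ω * D (n+1) ω ∂P = 0 := by
        simp only [hs, Finset.sum_mul]
        rw [integral_finsetSum _ fun i _ => hD2 i (n+1)]
        exact Finset.sum_eq_zero fun i hi => horth i (n+1) (by have := Finset.mem_Icc.mp hi; omega)
      have b : ∫ ω, D (n+1) ω * D (n+1) ω ∂P ≤ C ^ 2 := by
        have : ∫ ω, D (n+1) ω * D (n+1) ω ∂P ≤ ∫ _, C ^ 2 ∂P := by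
          refine integral_mono_ae (hD2 _ _) (integrable_const _) ?_
          filter_upwards [hC (n+1)] with ω h1
          have := abs_le.mp h1
          nlinarith
        simpa using this
      have i12 : Integrable (fun ω => s n ω ^ 2 + 2 * (s n ω * D (n+1) ω)) P := i1.add i2
      rw [e]
      refine ⟨(i1.add i2).add (hD2 _ _), ?_⟩
      rw [integral_add i12 (hD2 _ _), integral_add i1 i2, integral_const_mul, z]
      push_cast
      linarith [ih.2]
  have hsq : ∀ᵐ ω ∂P, Tendsto (fun m : ℕ => ((m^2 : ℕ) : ℝ)⁻¹ * s (m^2) ω) atTop (𝓝 0) := by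
    have hI : ∀ m : ℕ, Integrable (fun ω => (((m^2 : ℕ) : ℝ)⁻¹ * s (m^2) ω) ^ 2) P := fun m => by
      simp only [mul_pow]; exact (hss _).1.const_mul _
    have hfin : ∫⁻ ω, ∑' m : ℕ, ENNReal.ofReal ((((m^2 : ℕ) : ℝ)⁻¹ * s (m^2) ω) ^ 2) ∂P ≠ ⊤ := by
      rw [lintegral_tsum fun m => (hI m).aestronglyMeasurable.aemeasurable.ennreal_ofReal]
      have hle : ∀ m : ℕ, ∫⁻ ω, ENNReal.ofReal ((((m^2 : ℕ) : ℝ)⁻¹ * s (m^2) ω) ^ 2) ∂P ≤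
          ENNReal.ofReal (C ^ 2 * (1 / (m:ℝ) ^ 2)) := by
        intro m
        rw [← ofReal_integral_eq_lintegral_ofReal (hI m) (ae_of_all _ fun ω => sq_nonneg _)]
        apply ENNReal.ofReal_le_ofReal
        simp only [mul_pow]
        rw [integral_const_mul]
        have := (hss (m^2)).2
        rcases Nat.eq_zero_or_pos m with rfl | hm
        · simp
        · have hm' : (0:ℝ) < m := by exact_mod_cast hm
          calc _ ≤ (((m^2 : ℕ) : ℝ)⁻¹)^2 * (((m^2 : ℕ) : ℝ) * C^2) := by gcongr
            _ = _ := by push_cast; field_simp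
      refine ne_top_of_le_ne_top ?_ (ENNReal.tsum_le_tsum hle)
      have hsum : Summable fun m : ℕ => C ^ 2 * (1 / (m:ℝ) ^ 2) :=
        (Real.summable_one_div_nat_pow.mpr (by norm_num)).mul_left _
      rw [← ENNReal.ofReal_tsum_of_nonneg (fun m => by positivity) hsum]
      exact ENNReal.ofReal_ne_top
    have hae := ae_lt_top' (AEMeasurable.tsum fun m =>
      (hI m).aestronglyMeasurable.aemeasurable.ennreal_ofReal) hfin
    filter_upwards [hae] with ω hω
    have h1 := ENNReal.tendsto_atTop_zero_of_tsum_ne_top hω.ne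
    have h2 := (ENNReal.tendsto_toReal ENNReal.zero_ne_top).comp h1
    have h3 : Tendsto (fun m : ℕ => (((m^2 : ℕ) : ℝ)⁻¹ * s (m^2) ω) ^ 2) atTop (𝓝 0) := by
      refine h2.congr fun m => ?_
      simp only [Function.comp_apply]
      exact ENNReal.toReal_ofReal (sq_nonneg _)
    have h4 := h3.sqrt
    simp only [Real.sqrt_sq_eq_abs, Real.sqrt_zero] at h4
    exact (tendsto_zero_iff_abs_tendsto_zero _).mpr h4
  have hall : ∀ᵐ ω ∂P, ∀ k, |D k ω| ≤ C := ae_all_iff.mpr hC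
  filter_upwards [hsq, hall] with ω h1 h2
  have hsqrt : Tendsto Nat.sqrt atTop atTop := by
    refine tendsto_atTop_atTop.mpr fun b => ⟨b * b, fun n hn => Nat.le_sqrt.mpr hn⟩
  have h3 : Tendsto (fun m : ℕ => |((m^2 : ℕ) : ℝ)⁻¹ * s (m^2) ω| + 2 * C * (m:ℝ)⁻¹) atTop (𝓝 0) := by
    have a1 := h1.abs
    have a2 := (tendsto_inv_atTop_nhds_zero_nat (𝕜 := ℝ)).const_mul (2 * C)
    simpa using a1.add a2
  refine squeeze_zero_norm' ?_ (h3.comp hsqrt)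
  filter_upwards [eventually_ge_atTop 1] with n hn
  simp only [Function.comp_apply]
  set m := Nat.sqrt n with hm
  have hm1 : 1 ≤ m := Nat.le_sqrt.mpr (by omega)
  have hmn : m ^ 2 ≤ n := Nat.sqrt_le' n
  have hnm : n ≤ m ^ 2 + 2 * m := by
    have := Nat.sqrt_le_add n
    rw [← hm] at this; nlinarith
  have hm' : (0:ℝ) < m := by exact_mod_cast hm1
  have hn' : (0:ℝ) < n := by exact_mod_cast hn
  have hmn' : (m:ℝ)^2 ≤ n := by exact_mod_cast hmn
  have hnm' : (n:ℝ) ≤ (m:ℝ)^2 + 2 * m := by exact_mod_cast hnm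
  have hdiff : |s n ω| ≤ |s (m^2) ω| + 2 * m * C := by
    have e : s n ω = s (m^2) ω + ∑ k ∈ Finset.Ioc (m^2) n, D k ω := by
      have := Finset.sum_Ioc_consecutive (fun k => D k ω) (Nat.zero_le (m^2)) hmn
      exact this.symm
    rw [e]
    refine (abs_add_le _ _).trans ?_
    gcongr
    refine (Finset.abs_sum_le_sum_abs _ _).trans ((Finset.sum_le_sum fun k _ => h2 k).trans ?_)
    rw [Finset.sum_const, Nat.card_Ioc, nsmul_eq_mul, Nat.cast_sub hmn]
    push_cast
    gcongr
    linarith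
  rw [Real.norm_eq_abs, abs_mul, abs_mul, abs_of_pos (inv_pos.mpr hn'),
    abs_of_pos (by positivity : (0:ℝ) < ((m^2 : ℕ) : ℝ)⁻¹)]
  calc (n:ℝ)⁻¹ * |s n ω| ≤ ((m^2 : ℕ) : ℝ)⁻¹ * (|s (m^2) ω| + 2 * m * C) := by
        push_cast
        gcongr
    _ = _ := by push_cast; field_simp
end

section
variable {Ω : Type*}

lemma condExp_comp_mp {m : MeasurableSpace Ω} {m0 : MeasurableSpace Ω} {P : Measure Ω} [IsProbabilityMeasure P]
    {T : Ω → Ω} (hT : MeasurePreserving T P P) (hm : m ≤ m0)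
    {f : Ω → ℝ} (hf : Integrable f P) :
    P[fun ω => f (T ω) | MeasurableSpace.comap T m] =ᵐ[P] fun ω => (P[f | m]) (T ω) := by
  have hle : MeasurableSpace.comap T m ≤ m0 :=
    (MeasurableSpace.comap_mono hm).trans hT.measurable.comap_le
  symm
  have hi : Integrable (fun ω => (P[f | m]) (T ω)) P :=
    hT.integrable_comp_of_integrable integrable_condExp
  refine ae_eq_condExp_of_forall_setIntegral_eq hle (hT.integrable_comp_of_integrable hf)
    (fun s _ _ => hi.integrableOn) ?_ ?_
  · rintro s ⟨B, hB, rfl⟩ _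
    have key : ∀ g : Ω → ℝ, Integrable g P → ∫ x in T ⁻¹' B, g (T x) ∂P = ∫ x in B, g x ∂P := by
      intro g hg
      have := setIntegral_map (μ := P) (g := T) (f := g) (hm B hB)
        (by rw [hT.map_eq]; exact hg.aestronglyMeasurable) hT.measurable.aemeasurable
      rw [hT.map_eq] at this
      exact this.symm
    rw [key _ integrable_condExp, key _ hf, setIntegral_condExp hm hf hB]
  · refine StronglyMeasurable.aestronglyMeasurable ?_
    exact (stronglyMeasurable_condExp (m := m)).comp_measurable (comap_measurable T)

lemma aesm_of_modP {m₁ m₂ : MeasurableSpace Ω} {m0 : MeasurableSpace Ω} {P : Measure Ω} [IsProbabilityMeasure P]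
    (hm1 : m₁ ≤ m0) (hm2 : m₂ ≤ m0)
    (h : ∀ A : Set Ω, MeasurableSet[m₂] A → ∃ B : Set Ω, MeasurableSet[m₁] B ∧ P (A ∆ B) = 0)
    {f : Ω → ℝ} (hf : StronglyMeasurable[m₂] f) : AEStronglyMeasurable[m₁] f P := by
  have hs : ∀ g : @SimpleFunc Ω m₂ ℝ, AEStronglyMeasurable[m₁] (g : Ω → ℝ) P := by
    intro g
    induction g using SimpleFunc.induction with
    | @const c s hs =>
      obtain ⟨B, hB, hAB⟩ := h s hs
      refine ⟨B.indicator fun _ => c, (stronglyMeasurable_const).indicator hB, ?_⟩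
      have hsB : s =ᵐ[P] B := measure_symmDiff_eq_zero_iff.mp hAB
      have := indicator_ae_eq_of_ae_eq_set (μ := P) (f := fun _ : Ω => c) hsB
      simp only [SimpleFunc.coe_piecewise, SimpleFunc.coe_const, SimpleFunc.const_zero, SimpleFunc.coe_zero, Set.piecewise_eq_indicator]
      exact this
    | add _ h1 h2 => exact AEStronglyMeasurable.add h1 h2
  have h2 : ∀ n, ∃ g, StronglyMeasurable[m₁] g ∧ (hf.approx n : Ω → ℝ) =ᵐ[P] g := fun n => hs _
  choose g hg hfg using h2
  refine ⟨fun ω => limsup (fun n => g n ω) atTop, ?_, ?_⟩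
  · exact Measurable.stronglyMeasurable (Measurable.limsup fun n => (hg n).measurable)
  · filter_upwards [ae_all_iff.mpr hfg] with ω hω
    have := hf.tendsto_approx ω
    simp only [hω] at this
    exact this.limsup_eq.symm

noncomputable def KL (m : MeasurableSpace Ω) {m0 : MeasurableSpace Ω} (P : Measure Ω) :
    Submodule ℝ (Lp ℝ 2 P) := lpMeas ℝ ℝ m 2 P

lemma KL_complete {m m0 : MeasurableSpace Ω} (P : Measure Ω) (hm : m ≤ m0) :
    CompleteSpace (KL m P) := by
  have : Fact (m ≤ m0) := ⟨hm⟩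
  change CompleteSpace (lpMeas ℝ ℝ m 2 P)
  infer_instance

lemma mem_KL {m m0 : MeasurableSpace Ω} {P : Measure Ω} {x : Lp ℝ 2 P} :
    x ∈ KL m P ↔ AEStronglyMeasurable[m] x P :=
  mem_lpMeas_iff_aestronglyMeasurable

lemma KL_proj {m m0 : MeasurableSpace Ω} {P : Measure Ω} [IsProbabilityMeasure P] (hm : m ≤ m0)
    [CompleteSpace (KL m P)] {f : Ω → ℝ} (hf : MemLp f 2 P) :
    ((KL m P).starProjection (hf.toLp f) : Ω → ℝ) =ᵐ[P] P[f | m] :=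
  hf.condExpL2_ae_eq_condExp hm (𝕜 := ℝ)

lemma reverse_martingale {Z : MeasurableSpace Ω} {m0 : MeasurableSpace Ω} {P : Measure Ω} [IsProbabilityMeasure P]
    {𝒜 : ℕ → MeasurableSpace Ω} (hle : ∀ j, 𝒜 j ≤ m0) (hanti : Antitone 𝒜)
    (hZ : ∀ j, Z ≤ 𝒜 j)
    (h : ∀ A : Set Ω, MeasurableSet[⨅ j, 𝒜 j] A → ∃ B : Set Ω, MeasurableSet[Z] B ∧ P (A ∆ B) = 0)
    {f : Ω → ℝ} (hf : MemLp f 2 P) :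
    Tendsto (fun j => eLpNorm (P[f | 𝒜 j] - P[f | Z]) 1 P) atTop (𝓝 0) := by
  have hZ0 : Z ≤ m0 := (hZ 0).trans (hle 0)
  have : ∀ j, CompleteSpace (KL (𝒜 j) P) := fun j => KL_complete P (hle j)
  have := KL_complete P hZ0
  have hinf : ⨅ j, KL (𝒜 j) P = KL Z P := by
    apply le_antisymm
    · intro x hx
      rw [Submodule.mem_iInf] at hx
      have hx' := fun j => mem_KL.mp (hx j)
      choose g hg hxg using hx'
      have hG : StronglyMeasurable[⨅ j, 𝒜 j] (fun ω => limsup (fun n => g n ω) atTop) := by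
        refine Measurable.stronglyMeasurable ?_
        intro s hs
        rw [MeasurableSpace.measurableSet_iInf]
        intro N
        have : (fun ω => limsup (fun n => g n ω) atTop) =
            fun ω => limsup (fun n => g (n + N) ω) atTop := by
          ext ω; exact (limsup_nat_add (fun n => g n ω) N).symm
        rw [this]
        exact (Measurable.limsup fun n => ((hg (n+N)).mono (hanti (by omega))).measurable) hs
      rw [mem_KL]
      refine (aesm_of_modP hZ0 ((iInf_le _ 0).trans (hle 0)) h hG).congr ?_
      filter_upwards [ae_all_iff.mpr hxg] with ω hω
      simp only [← hω]
      simp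
    · refine le_iInf fun j x hx => mem_KL.mpr ?_
      exact (mem_KL.mp hx).mono (hZ j)
  have hmono : Monotone fun j => (KL (𝒜 j) P)ᗮ := fun i j hij =>
    Submodule.orthogonal_le fun x hx => mem_KL.mpr ((mem_KL.mp hx).mono (hanti hij))
  have hcl : (⨆ j, (KL (𝒜 j) P)ᗮ).topologicalClosure = (KL Z P)ᗮ := by
    rw [← Submodule.orthogonal_orthogonal_eq_closure, ← Submodule.iInf_orthogonal]
    simp only [Submodule.orthogonal_orthogonal]
    rw [hinf]
  set x := hf.toLp f
  have : (⨆ j, (KL (𝒜 j) P)ᗮ).topologicalClosure.HasOrthogonalProjection := by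
    rw [hcl]; infer_instance
  have h1 := Submodule.starProjection_tendsto_closure_iSup (fun j => (KL (𝒜 j) P)ᗮ) hmono x
  simp only [hcl, Submodule.starProjection_orthogonal_val] at h1
  have h2 : Tendsto (fun j => (KL (𝒜 j) P).starProjection x) atTop (𝓝 ((KL Z P).starProjection x)) := by
    have := (tendsto_const_nhds (x := x)).sub h1
    simpa using this
  rw [Lp.tendsto_Lp_iff_tendsto_eLpNorm'] at h2
  refine tendsto_of_tendsto_of_tendsto_of_le_of_le tendsto_const_nhds h2 (fun _ => bot_le) fun j => ?_
  have e : eLpNorm (P[f | 𝒜 j] - P[f | Z]) 1 P = 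
    eLpNorm (⇑((KL (𝒜 j) P).starProjection x) - ⇑((KL Z P).starProjection x)) 1 P :=
    eLpNorm_congr_ae ((KL_proj (hle j) hf).symm.sub (KL_proj hZ0 hf).symm)
  dsimp only
  rw [e]
  exact eLpNorm_le_eLpNorm_of_exponent_le (by norm_num) 
    ((Lp.aestronglyMeasurable _).sub (Lp.aestronglyMeasurable _))
end

section
variable {Ω : Type*}

/-- `h` is good if all its adapted weighted ergodic averages vanish. -/
def Good (Z : MeasurableSpace Ω) {m0 : MeasurableSpace Ω} (P : Measure Ω) (T : Ω → Ω)
    (h : Ω → ℝ) : Prop :=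
  ∀ w : ℕ → Ω → ℝ, (∀ k, StronglyMeasurable[MeasurableSpace.comap T^[k] Z] (w k)) →
    (∀ k ω, |w k ω| ≤ 1) → ∀ᵐ ω ∂P, Ces (fun k => w k ω * h (T^[k] ω))

lemma comap_iter_mono {M : MeasurableSpace Ω} {T : Ω → Ω} (h : M ≤ MeasurableSpace.comap T M) :
    Monotone fun k => MeasurableSpace.comap T^[k] M := by
  refine monotone_nat_of_le_succ fun k => ?_
  rw [Function.iterate_succ', ← MeasurableSpace.comap_comp]
  exact MeasurableSpace.comap_mono h

lemma good_add {Z m0 : MeasurableSpace Ω} {P : Measure Ω} {T : Ω → Ω} {f g : Ω → ℝ}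
    (hf : Good Z P T f) (hg : Good Z P T g) : Good Z P T (fun ω => f ω + g ω) := by
  intro w hw hb
  filter_upwards [hf w hw hb, hg w hw hb] with ω h1 h2
  simpa [mul_add] using h1.add h2

lemma good_congr {Z m0 : MeasurableSpace Ω} {P : Measure Ω} {T : Ω → Ω}
    (hT : MeasurePreserving T P P) {f g : Ω → ℝ} (hfg : f =ᵐ[P] g)
    (hf : Good Z P T f) : Good Z P T g := by
  intro w hw hb
  have : ∀ᵐ ω ∂P, ∀ k, f (T^[k] ω) = g (T^[k] ω) := ae_all_iff.mpr fun k =>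
    (hT.iterate k).quasiMeasurePreserving.ae hfg
  filter_upwards [hf w hw hb, this] with ω h1 h2
  simpa only [h2] using h1

lemma good_approx {Z m0 : MeasurableSpace Ω} {P : Measure Ω} [IsProbabilityMeasure P] {T : Ω → Ω}
    (hT : MeasurePreserving T P P) {h : Ω → ℝ} (hi : Integrable h P)
    (H : ∀ ε : ℝ, 0 < ε → ∃ g, Integrable g P ∧ Good Z P T g ∧ ∫ ω, |h ω - g ω| ∂P ≤ ε) :
    Good Z P T h := by
  intro w hw hb
  apply ces_of_approx hT
  intro ε hε
  obtain ⟨g, hgi, hg, hle⟩ := H ε hε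
  refine ⟨fun ω => h ω - g ω, fun k ω => w k ω * g (T^[k] ω), hi.sub hgi, hle, hg w hw hb, ?_⟩
  intro k _
  refine ae_of_all _ fun ω => ?_
  dsimp only
  rw [← mul_sub, abs_mul]
  exact mul_le_of_le_one_left (abs_nonneg _) (hb k ω)

lemma good_md {Z A A' m0 : MeasurableSpace Ω} {P : Measure Ω} [IsProbabilityMeasure P] {T : Ω → Ω}
    (hT : MeasurePreserving T P P) (hZ : Z ≤ MeasurableSpace.comap T Z) (hZA : Z ≤ A')
    (hAA : A' ≤ A) (hA : A ≤ m0) (hAT : A ≤ MeasurableSpace.comap T A') {d : Ω → ℝ} {C : ℝ}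
    (hd : StronglyMeasurable[A] d) (hC : ∀ᵐ ω ∂P, |d ω| ≤ C) (h0 : P[d | A'] =ᵐ[P] 0) :
    Good Z P T d := by
  intro w hw hb
  have hTk := fun k => hT.iterate k
  have hcm : ∀ k, MeasurableSpace.comap T^[k] A ≤ m0 := fun k =>
    (MeasurableSpace.comap_mono hA).trans (hTk k).measurable.comap_le
  have hA' : A' ≤ m0 := hAA.trans hA
  have hwm : ∀ k, StronglyMeasurable[MeasurableSpace.comap T^[k] A'] (w k) := fun k =>
    (hw k).mono (MeasurableSpace.comap_mono hZA)
  have hdk : ∀ k, StronglyMeasurable[MeasurableSpace.comap T^[k] A] (fun ω => d (T^[k] ω)) :=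
    fun k => hd.comp_measurable (comap_measurable _)
  have hDm : ∀ k, StronglyMeasurable[MeasurableSpace.comap T^[k] A]
      (fun ω => w k ω * d (T^[k] ω)) := fun k =>
    ((hwm k).mono (MeasurableSpace.comap_mono hAA)).mul (hdk k)
  have hCk : ∀ k, ∀ᵐ ω ∂P, |d (T^[k] ω)| ≤ C := fun k =>
    (hTk k).quasiMeasurePreserving.ae hC
  have hDC : ∀ k, ∀ᵐ ω ∂P, |w k ω * d (T^[k] ω)| ≤ C := fun k => by
    filter_upwards [hCk k] with ω h1
    rw [abs_mul]
    exact (mul_le_of_le_one_left (abs_nonneg _) (hb k ω)).trans h1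
  have hdi : ∀ k, Integrable (fun ω => d (T^[k] ω)) P := fun k =>
    (integrable_const C).mono' ((hdk k).mono (hcm k)).aestronglyMeasurable (hCk k)
  have hd0 : Integrable d P := (integrable_const C).mono' (hd.mono hA).aestronglyMeasurable hC
  refine ces_of_orthogonal (C := C) (fun k => ((hDm k).mono (hcm k)).aestronglyMeasurable) hDC ?_
  intro i j hij
  have hmono := comap_iter_mono (hAA.trans hAT)
  have hij' : MeasurableSpace.comap T^[i] A ≤ MeasurableSpace.comap T^[j] A' := by
    refine le_trans ?_ (hmono (show i + 1 ≤ j from hij))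
    dsimp only
    rw [Function.iterate_succ', ← MeasurableSpace.comap_comp]
    exact MeasurableSpace.comap_mono hAT
  set F : Ω → ℝ := fun ω => (w i ω * d (T^[i] ω)) * w j ω
  have hF : StronglyMeasurable[MeasurableSpace.comap T^[j] A'] F :=
    ((hDm i).mono hij').mul (hwm j)
  have hFb : ∀ᵐ ω ∂P, ‖F ω‖ ≤ C := by
    filter_upwards [hDC i] with ω h1
    rw [Real.norm_eq_abs, abs_mul]
    exact (mul_le_of_le_one_right (abs_nonneg _) (hb j ω)).trans h1
  have hcle : MeasurableSpace.comap T^[j] A' ≤ m0 :=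
    (MeasurableSpace.comap_mono hAA).trans (hcm j)
  have e1 := condExp_stronglyMeasurable_mul_of_bound hcle hF (hdi j) C hFb
  have e2 := condExp_comp_mp (hTk j) hA' hd0
  have e3 := (hTk j).quasiMeasurePreserving.ae h0
  have e4 : ∫ ω, (w i ω * d (T^[i] ω)) * (w j ω * d (T^[j] ω)) ∂P =
      ∫ ω, (F * fun ω => d (T^[j] ω)) ω ∂P := by
    congr 1; ext ω; simp only [F, Pi.mul_apply]; ring
  rw [e4, ← integral_condExp hcle]
  rw [integral_congr_ae (g := fun _ => (0:ℝ))]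
  · simp
  · filter_upwards [e1, e2, e3] with ω h1 h2 h3
    rw [h1, Pi.mul_apply, h2, h3]; simp

lemma good_stage1 {Z m0 : MeasurableSpace Ω} {P : Measure Ω} [IsProbabilityMeasure P] {T : Ω → Ω}
    (hT : MeasurePreserving T P P) (hZ : Z ≤ MeasurableSpace.comap T Z)
    {𝒜 : ℕ → MeasurableSpace Ω} (hle : ∀ j, 𝒜 j ≤ m0) (hanti : Antitone 𝒜)
    (hZA : ∀ j, Z ≤ 𝒜 j) (hAT : ∀ j, 𝒜 j ≤ MeasurableSpace.comap T (𝒜 (j+1)))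
    (htail : ∀ A : Set Ω, MeasurableSet[⨅ j, 𝒜 j] A → ∃ B : Set Ω, MeasurableSet[Z] B ∧ P (A ∆ B) = 0)
    {f : Ω → ℝ} {C : NNReal} (hf : StronglyMeasurable[𝒜 0] f) (hC : ∀ᵐ ω ∂P, |f ω| ≤ C) :
    Good Z P T (fun ω => f ω - (P[f | Z]) ω) := by
  have hZ0 : Z ≤ m0 := (hZA 0).trans (hle 0)
  have hfm := (hf.mono (hle 0)).aestronglyMeasurable (μ := P)
  have hfi : Integrable f P := (integrable_const (C:ℝ)).mono' hfm hC
  have hf2 : MemLp f 2 P := MemLp.of_bound hfm C hC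
  have hcC : ∀ j, ∀ᵐ ω ∂P, |(P[f | 𝒜 j]) ω| ≤ C := fun j => ae_bdd_abs_condExp_of_ae_bdd_abs hC
  have hJ : ∀ J, Good Z P T (fun ω => f ω - (P[f | 𝒜 J]) ω) := by
    intro J
    induction J with
    | zero =>
      rw [condExp_of_stronglyMeasurable (hle 0) hf hfi]
      intro w hw hb
      refine ae_of_all _ fun ω => ces_of_tendsto ?_
      simp
    | succ J ih =>
      have hg : Good Z P T (P[f | 𝒜 J] - P[f | 𝒜 (J+1)]) := by
        refine good_md hT hZ (hZA (J+1)) (hanti (Nat.le_succ J)) (hle J) (hAT J) (C := C + C) ?_ ?_ ?_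
        · exact stronglyMeasurable_condExp.sub
            (stronglyMeasurable_condExp.mono (hanti (Nat.le_succ J)))
        · filter_upwards [hcC J, hcC (J+1)] with ω h1 h2
          rw [Pi.sub_apply]
          exact (abs_sub _ _).trans (add_le_add h1 h2)
        · have h1 := condExp_sub (integrable_condExp (f := f) (m := 𝒜 J) (μ := P))
            (integrable_condExp (f := f) (m := 𝒜 (J+1)) (μ := P)) (𝒜 (J+1))
          have h2 := condExp_condExp_of_le (μ := P) (f := f) (hanti (Nat.le_succ J)) (hle J)
          have h3 := condExp_of_stronglyMeasurable (hle (J+1))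
            (stronglyMeasurable_condExp (f := f) (m := 𝒜 (J+1)) (μ := P)) integrable_condExp
          filter_upwards [h1, h2] with ω e1 e2
          rw [e1, Pi.sub_apply, e2, h3]; simp
      have := good_add ih hg
      convert this using 2 with ω
      rw [Pi.sub_apply]; ring
  refine good_approx hT (hfi.sub integrable_condExp) fun ε hε => ?_
  have hrev := reverse_martingale hle hanti hZA htail hf2
  obtain ⟨J, hJε⟩ := ((tendsto_order.1 hrev).2 (ENNReal.ofReal ε) (by simpa using hε)).exists
  refine ⟨_, hfi.sub integrable_condExp, hJ J, ?_⟩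
  have e : ∀ ω, |(f ω - (P[f | Z]) ω) - (f ω - (P[f | 𝒜 J]) ω)| =
      ‖(P[f | 𝒜 J] - P[f | Z]) ω‖ := fun ω => by
    rw [Real.norm_eq_abs, Pi.sub_apply]; congr 1; ring
  change ∫ ω, |(f ω - (P[f | Z]) ω) - (f ω - (P[f | 𝒜 J]) ω)| ∂P ≤ ε
  simp only [e]
  rw [integral_norm_eq_lintegral_enorm (integrable_condExp.sub integrable_condExp).aestronglyMeasurable,
    ← eLpNorm_one_eq_lintegral_enorm]
  exact ENNReal.toReal_le_of_le_ofReal hε.le hJε.le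

lemma good_main {Z m0 : MeasurableSpace Ω} {P : Measure Ω} [IsProbabilityMeasure P] {T : Ω → Ω}
    (hT : MeasurePreserving T P P) (hZ0 : Z ≤ m0) (hZ : Z ≤ MeasurableSpace.comap T Z)
    {X : ℤ → MeasurableSpace Ω} (hle : ∀ i, X i ≤ m0) (hmono : Monotone X)
    (hXT : ∀ i, X (i+1) = MeasurableSpace.comap T (X i))
    (htail : ∀ A : Set Ω, MeasurableSet[⨅ k : ℕ, Z ⊔ X (-((k:ℤ)+1))] A →
      ∃ B : Set Ω, MeasurableSet[Z] B ∧ P (A ∆ B) = 0)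
    (hgen : ∀ A : Set Ω, MeasurableSet[m0] A →
      ∃ B : Set Ω, MeasurableSet[⨆ k : ℕ, X ((k:ℤ)+1)] B ∧ P (A ∆ B) = 0)
    {f : Ω → ℝ} (hf : Integrable f P) :
    Good Z P T (fun ω => f ω - (P[f | Z]) ω) := by
  have st1 : ∀ (n : ℕ) (g : Ω → ℝ) (C : NNReal), StronglyMeasurable[X ((n:ℤ)+1)] g →
      (∀ᵐ ω ∂P, |g ω| ≤ C) → Good Z P T (fun ω => g ω - (P[g | Z]) ω) := by
    intro n g C hg hC
    refine good_stage1 hT hZ (𝒜 := fun j : ℕ => Z ⊔ X ((n:ℤ) + 1 - j)) (C := C)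
      (fun j => sup_le hZ0 (hle _)) ?_ (fun j => le_sup_left) ?_ ?_ ?_ hC
    · intro i j hij
      exact sup_le_sup le_rfl (hmono (by omega))
    · intro j
      rw [MeasurableSpace.comap_sup, ← hXT]
      exact sup_le_sup hZ (hmono (by push_cast; omega))
    · intro A hA
      refine htail A ((?_ : (⨅ j : ℕ, Z ⊔ X ((n:ℤ) + 1 - j)) ≤ _) A hA)
      refine le_iInf fun k => (iInf_le _ (n + k + 2)).trans ?_
      exact sup_le_sup le_rfl (hmono (by push_cast; omega))
    · refine hg.mono ?_
      simp
  refine good_approx hT (hf.sub integrable_condExp) fun ε hε => ?_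
  obtain ⟨s, hs, hs1⟩ := (memLp_one_iff_integrable.mpr hf).exists_simpleFunc_eLpNorm_sub_lt
    ENNReal.one_ne_top (ε := ENNReal.ofReal (ε/4)) (by simpa using hε)
  have hsi : Integrable s P := memLp_one_iff_integrable.mp hs1
  obtain ⟨C, hC⟩ := s.exists_forall_norm_le
  have hC' : ∀ᵐ ω ∂P, |s ω| ≤ (Real.toNNReal C : ℝ) := ae_of_all _ fun ω =>
    (hC ω).trans (Real.le_coe_toNNReal C)
  let ℱ : Filtration ℕ m0 := ⟨fun k => X ((k:ℤ)+1), fun i j hij => hmono (by omega), fun k => hle _⟩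
  have hlim := tendsto_eLpNorm_condExp (μ := P) (ℱ := ℱ) s
  have hsm : P[s | ⨆ n, ℱ n] =ᵐ[P] s := by
    refine condExp_of_aestronglyMeasurable' (iSup_le fun n => ℱ.le n) ?_ hsi
    exact aesm_of_modP (iSup_le fun n => ℱ.le n) le_rfl hgen s.stronglyMeasurable
  obtain ⟨n, hn⟩ := ((tendsto_order.1 hlim).2 (ENNReal.ofReal (ε/4)) (by simpa using hε)).exists
  set g := P[s | X ((n:ℤ)+1)] with hg
  have hgi : Integrable g P := integrable_condExp
  have hn' : eLpNorm (g - ⇑s) 1 P < ENNReal.ofReal (ε/4) := by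
    rw [← eLpNorm_congr_ae ((EventuallyEq.refl _ g).sub hsm)]
    exact hn
  refine ⟨_, hgi.sub integrable_condExp, st1 n g _ stronglyMeasurable_condExp
    (ae_bdd_abs_condExp_of_ae_bdd_abs hC'), ?_⟩
  have L : ∀ h : Ω → ℝ, Integrable h P → eLpNorm h 1 P < ENNReal.ofReal (ε/4) →
      ∫ ω, |h ω| ∂P ≤ ε/4 := by
    intro h hh hlt
    have := integral_norm_eq_lintegral_enorm hh.aestronglyMeasurable
    simp only [Real.norm_eq_abs] at this
    rw [this, ← eLpNorm_one_eq_lintegral_enorm]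
    exact ENNReal.toReal_le_of_le_ofReal (by positivity) hlt.le
  have l1 := L _ (hf.sub hsi) hs
  have l2 := L _ (hgi.sub hsi) hn'
  have hfg : Integrable (f - g) P := hf.sub hgi
  have l3 : ∫ ω, |(f - g) ω| ∂P ≤ ε/2 := by
    have : ∫ ω, |(f - g) ω| ∂P ≤ ∫ ω, (|(f - ⇑s) ω| + |(g - ⇑s) ω|) ∂P := by
      refine integral_mono hfg.abs ((hf.sub hsi).abs.add (hgi.sub hsi).abs) fun ω => ?_
      simp only [Pi.sub_apply]
      have : f ω - g ω = (f ω - s ω) - (g ω - s ω) := by ring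
      rw [this]; exact abs_sub _ _
    rw [integral_add (hf.sub hsi).abs (hgi.sub hsi).abs] at this
    linarith
  have l4 : ∫ ω, |(P[f - g | Z]) ω| ∂P ≤ ε/2 := (integral_abs_condExp_le _).trans l3
  have e : ∀ᵐ ω ∂P, |(f - P[f|Z]) ω - (g - P[g|Z]) ω| ≤ |(f - g) ω| + |(P[f - g | Z]) ω| := by
    filter_upwards [condExp_sub hf hgi Z] with ω h1
    rw [h1]
    simp only [Pi.sub_apply]
    have : f ω - (P[f|Z]) ω - (g ω - (P[g|Z]) ω) = (f ω - g ω) - ((P[f|Z]) ω - (P[g|Z]) ω) := by ring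
    rw [this]; exact abs_sub _ _
  have := integral_mono_ae ((hf.sub integrable_condExp).sub (hgi.sub integrable_condExp)).abs
    (hfg.abs.add integrable_condExp.abs) e
  refine this.trans ?_
  change ∫ ω, (|(f - g) ω| + |(P[f - g | Z]) ω|) ∂P ≤ ε
  rw [integral_add hfg.abs integrable_condExp.abs]
  linarith
end

section
variable {Ω U : Type*}

lemma iter_eq {T S : Ω → Ω} (hST : Function.LeftInverse S T) (hTS : Function.RightInverse S T)
    (n : ℤ) : iter T S n = ⇑((⟨T, S, hST, hTS⟩ : Equiv.Perm Ω) ^ n) := by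
  set e : Equiv.Perm Ω := ⟨T, S, hST, hTS⟩
  cases n with
  | ofNat n =>
    rw [Int.ofNat_eq_natCast, zpow_natCast, ← Equiv.Perm.iterate_eq_pow]
    rfl
  | negSucc n =>
    rw [zpow_negSucc, ← inv_pow, ← Equiv.Perm.iterate_eq_pow]
    rfl

lemma iter_add {T S : Ω → Ω} (hST : Function.LeftInverse S T) (hTS : Function.RightInverse S T)
    (k : ℤ) (n : ℕ) : iter T S (k + n) = iter T S k ∘ T^[n] := by
  have h : T^[n] = iter T S (n : ℤ) := rfl
  rw [h, iter_eq hST hTS, iter_eq hST hTS, iter_eq hST hTS, zpow_add, Equiv.Perm.coe_mul]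

lemma iter_measurable {m0 : MeasurableSpace Ω} {T S : Ω → Ω} (hT : Measurable T)
    (hS : Measurable S) (n : ℤ) : Measurable (iter T S n) := by
  cases n with
  | ofNat n => exact hT.iterate n
  | negSucc n => exact hS.iterate (n+1)

lemma comap_iter_add {T S : Ω → Ω} (hST : Function.LeftInverse S T)
    (hTS : Function.RightInverse S T) (Y : MeasurableSpace Ω) (k : ℤ) (n : ℕ) :
    MeasurableSpace.comap T^[n] (MeasurableSpace.comap (iter T S k) Y) =
      MeasurableSpace.comap (iter T S (k + n)) Y := by
  rw [iter_add hST hTS, MeasurableSpace.comap_comp]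

lemma comap_obsField {T S : Ω → Ω} (hST : Function.LeftInverse S T)
    (hTS : Function.RightInverse S T) (Y : MeasurableSpace Ω) (n : ℕ) :
    MeasurableSpace.comap T^[n] (obsField T S Y (-(n:ℤ)) 0) = obsField T S Y 0 n := by
  unfold obsField
  simp only [MeasurableSpace.comap_iSup, comap_iter_add hST hTS]
  apply le_antisymm
  · refine iSup₂_le fun k hk => ?_
    exact le_iSup₂_of_le (k + n) ⟨by have := hk.1; omega, by have := hk.2; omega⟩ le_rfl
  · refine iSup₂_le fun k hk => ?_
    refine le_iSup₂_of_le (k - n) ⟨by have := hk.1; omega, by have := hk.2; omega⟩ ?_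
    rw [sub_add_cancel]

lemma obsField_le_LE {T S : Ω → Ω} (Y : MeasurableSpace Ω) (m : ℤ) :
    obsField T S Y m 0 ≤ obsFieldLE T S Y 0 :=
  iSup₂_le fun k hk => le_iSup₂_of_le (f := fun k (_ : k ∈ Set.Iic (0:ℤ)) =>
    MeasurableSpace.comap (iter T S k) Y) k hk.2 le_rfl

lemma obsFieldLE_le {Y m0 : MeasurableSpace Ω} {T S : Ω → Ω} (hT : Measurable T)
    (hS : Measurable S) (hY : Y ≤ m0) : obsFieldLE T S Y 0 ≤ m0 :=
  iSup₂_le fun k _ => (MeasurableSpace.comap_mono hY).trans (iter_measurable hT hS k).comap_le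

lemma iSup_obsField {T S : Ω → Ω} (Y : MeasurableSpace Ω) :
    ⨆ n : ℕ, obsField T S Y (-(n:ℤ)) 0 = obsFieldLE T S Y 0 := by
  apply le_antisymm
  · exact iSup_le fun n => obsField_le_LE Y _
  · refine iSup₂_le fun k hk => ?_
    have hk' : k ≤ 0 := hk
    refine le_iSup_of_le k.natAbs ?_
    exact le_iSup₂_of_le (f := fun j (_ : j ∈ Set.Icc (-(k.natAbs:ℤ)) 0) =>
      MeasurableSpace.comap (iter T S j) Y) k ⟨by omega, hk'⟩ le_rfl

lemma obsFieldLE_shift {T S : Ω → Ω} (hST : Function.LeftInverse S T)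
    (hTS : Function.RightInverse S T) (Y : MeasurableSpace Ω) :
    obsFieldLE T S Y 0 ≤ MeasurableSpace.comap T (obsFieldLE T S Y 0) := by
  conv_lhs => unfold obsFieldLE
  refine iSup₂_le fun k hk => ?_
  have hk' : k ≤ 0 := hk
  have h := comap_iter_add hST hTS Y (k - 1) 1
  rw [Nat.cast_one, sub_add_cancel, Function.iterate_one] at h
  rw [← h]
  refine MeasurableSpace.comap_mono ?_
  exact le_iSup₂_of_le (f := fun k (_ : k ∈ Set.Iic (0:ℤ)) =>
    MeasurableSpace.comap (iter T S k) Y) (k-1) (by rw [Set.mem_Iic]; omega) le_rfl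

/-- Representatives of the atoms of a finite measurable space. -/
lemma exists_rep [MeasurableSpace U] [Finite U] {m0 : MeasurableSpace Ω}
    (ℓ : U → Ω → ℝ) (hℓ : Measurable fun p : U × Ω => ℓ p.1 p.2) :
    ∃ r : U → U, (∀ u, ℓ (r u) = ℓ u) ∧ ∀ a, MeasurableSet (r ⁻¹' {a}) := by
  let s : Setoid U := Setoid.ker (fun x : U => measurableAtom x)
  let r : U → U := fun u => (Quotient.mk s u).out
  have hr : ∀ u, measurableAtom (r u) = measurableAtom u := fun u =>
    (Quotient.exact (Quotient.out_eq (Quotient.mk s u)) : s.r _ _)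
  have hr2 : ∀ u v, measurableAtom u = measurableAtom v → r u = r v := fun u v h => by
    have : Quotient.mk s u = Quotient.mk s v := Quotient.sound h
    simp only [r, this]
  refine ⟨r, fun u => ?_, fun a => ?_⟩
  · ext ω
    have hm : Measurable fun v => ℓ v ω := hℓ.comp (measurable_id.prodMk measurable_const)
    have hS : MeasurableSet {v | ℓ v ω = ℓ u ω} := hm (measurableSet_singleton _)
    have hmem : r u ∈ measurableAtom u := by rw [← hr u]; exact mem_measurableAtom_self _
    exact mem_of_mem_measurableAtom hmem hS rfl
  · by_cases h : ∃ u, r u = a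
    · obtain ⟨u, rfl⟩ := h
      have : r ⁻¹' {r u} = measurableAtom u := by
        ext v
        simp only [Set.mem_preimage, Set.mem_singleton_iff]
        constructor
        · intro hv
          have : measurableAtom v = measurableAtom u := by rw [← hr v, hv, hr u]
          rw [← this]; exact mem_measurableAtom_self _
        · intro hv
          exact hr2 _ _ (measurableAtom_eq_of_mem hv)
      rw [this]
      exact MeasurableSet.measurableAtom_of_countable u
    · have : r ⁻¹' {a} = ∅ := by
        ext v; simp only [Set.mem_preimage, Set.mem_singleton_iff, Set.mem_empty_iff_false, iff_false]
        exact fun hv => h ⟨v, hv⟩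
      rw [this]; exact MeasurableSet.empty

lemma liminf_nonneg_of_ces {c d : ℕ → ℝ} (hc : Ces c) (hcd : ∀ k, 1 ≤ k → c k ≤ d k) :
    0 ≤ liminf (fun n : ℕ => (n : ℝ)⁻¹ * ∑ k ∈ Finset.Icc 1 n, d k) atTop := by
  have hev : ∀ ε : ℝ, 0 < ε → ∀ᶠ n : ℕ in atTop,
      -ε ≤ (n : ℝ)⁻¹ * ∑ k ∈ Finset.Icc 1 n, d k := by
    intro ε hε
    filter_upwards [(tendsto_order.1 hc).1 (-ε) (by linarith)] with n hn
    refine hn.le.trans ?_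
    gcongr with k hk
    exact hcd k (Finset.mem_Icc.mp hk).1
  rw [liminf_eq]
  set A := {a : ℝ | ∀ᶠ n : ℕ in atTop, a ≤ (n : ℝ)⁻¹ * ∑ k ∈ Finset.Icc 1 n, d k}
  by_cases hA : BddAbove A
  · refine le_of_forall_pos_le_add fun ε hε => ?_
    have := le_csSup hA (show -ε ∈ A from hev ε hε)
    linarith
  · rw [Real.sSup_of_not_bddAbove hA]

lemma ces_neg {a : ℕ → ℝ} (ha : Ces a) : Ces (fun k => - a k) := by
  have := Tendsto.neg ha
  simpa [Ces] using this
end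


lemma hgood_aux {Ω : Type*} {X Z : MeasurableSpace Ω} {m0 : MeasurableSpace Ω}
    {P : Measure Ω} [IsProbabilityMeasure P]
    {T S : Ω → Ω} (hTm : MeasurePreserving T P P) (hS : MeasurePreserving S P P)
    (hST : Function.LeftInverse S T) (hTS : Function.RightInverse S T)
    (hZ0 : Z ≤ m0) (hZT : Z ≤ MeasurableSpace.comap T Z) (hX0 : X ≤ m0)
    (hXT : X ≤ MeasurableSpace.comap T X)
    (hgen : EqModP P (⨆ k : ℕ, MeasurableSpace.comap (T^[k + 1]) X) m0)
    (htail : EqModP P (⨅ k : ℕ, Z ⊔ MeasurableSpace.comap (S^[k + 1]) X) Z)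
    {f : Ω → ℝ} (hf : Integrable f P) : Good Z P T (fun ω => f ω - (P[f | Z]) ω) := by
  have hXm : Monotone fun i : ℤ => MeasurableSpace.comap (iter T S i) X := by
    refine monotone_int_of_le_succ fun i => ?_
    have h2 : iter T S (i + 1) = T ∘ iter T S i := by
      have h : iter T S (1 + i) = iter T S 1 ∘ iter T S i := by
        rw [iter_eq hST hTS, iter_eq hST hTS, iter_eq hST hTS, zpow_add, Equiv.Perm.coe_mul]
      rw [add_comm]
      exact h
    rw [h2, ← MeasurableSpace.comap_comp]
    exact MeasurableSpace.comap_mono hXT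
  refine good_main hTm hZ0 hZT (X := fun i : ℤ => MeasurableSpace.comap (iter T S i) X)
    (fun i => (MeasurableSpace.comap_mono hX0).trans
      (iter_measurable hTm.measurable hS.measurable i).comap_le) hXm ?_ ?_ ?_ hf
  · intro i
    exact (comap_iter_add hST hTS X i 1).symm
  · have e : ∀ k : ℕ, iter T S (-((k:ℤ)+1)) = S^[k+1] := fun k => by
      rw [show -((k:ℤ)+1) = Int.negSucc k by omega]; rfl
    have e2 : (⨅ k : ℕ, Z ⊔ MeasurableSpace.comap (iter T S (-((k:ℤ)+1))) X) =
        ⨅ k : ℕ, Z ⊔ MeasurableSpace.comap (S^[k + 1]) X := by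
      refine iInf_congr fun k => ?_
      rw [e]
    intro A hA
    exact htail.1 A (e2 ▸ hA)
  · exact hgen.2

lemma main_aux {Ω U : Type*} {Y Z : MeasurableSpace Ω} [m0 : MeasurableSpace Ω]
    [MeasurableSpace U] [Finite U]
    (P : Measure Ω) [IsProbabilityMeasure P]
    (T S : Ω → Ω) (hTm : MeasurePreserving T P P)
    (hST : Function.LeftInverse S T) (hTS : Function.RightInverse S T)
    (ℓ : U → Ω → ℝ) (hℓ : Measurable fun p : U × Ω => ℓ p.1 p.2)
    (hℓi : ∀ a, Integrable (ℓ a) P)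
    (hZdef : Z = obsFieldLE T S Y 0) (hZ0 : Z ≤ m0)
    (hgood : ∀ a, Good Z P T (fun ω => ℓ a ω - (P[ℓ a | Z]) ω))
    (ut : ℕ → Ω → U) (hut : MeanOptimalStrategy P T S Y ℓ ut) :
    PathwiseOptimal P T S Y ℓ ut := by
  classical
  obtain ⟨r, hr, hrm⟩ := exists_rep ℓ hℓ
  have : Fintype U := Fintype.ofFinite U
  refine ⟨hut.1, fun u hu => ?_⟩
  set 𝒢 : ℕ → MeasurableSpace Ω := fun n => obsField T S Y (-(n:ℤ)) 0 with h𝒢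
  have h𝒢Z : ∀ n, 𝒢 n ≤ Z := fun n => hZdef ▸ obsField_le_LE Y _
  have h𝒢T : ∀ n, MeasurableSpace.comap T^[n] (𝒢 n) = obsField T S Y 0 n :=
    fun n => comap_obsField hST hTS Y n
  have hobsZ : ∀ n : ℕ, obsField T S Y 0 n ≤ MeasurableSpace.comap T^[n] Z := fun n => by
    rw [← h𝒢T]; exact MeasurableSpace.comap_mono (h𝒢Z n)
  have hobs0 : ∀ n : ℕ, obsField T S Y 0 n ≤ m0 := fun n =>
    (hobsZ n).trans ((MeasurableSpace.comap_mono hZ0).trans (hTm.iterate n).measurable.comap_le)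
  -- indicators
  let I : (ℕ → Ω → U) → U → ℕ → Ω → ℝ := fun v a k ω => if r (v k ω) = a then 1 else 0
  have hIm : ∀ v, Admissible T S Y v → ∀ a (k : ℕ), 1 ≤ k →
      StronglyMeasurable[obsField T S Y 0 k] (I v a k) := by
    intro v hv a k hk
    have h1 : MeasurableSet[obsField T S Y 0 k] (v k ⁻¹' (r ⁻¹' {a})) := hv k hk (hrm a)
    exact StronglyMeasurable.ite h1 stronglyMeasurable_const stronglyMeasurable_const
  have hI01 : ∀ v a k ω, 0 ≤ I v a k ω ∧ I v a k ω ≤ 1 := by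
    intro v a k ω
    simp only [I]; split_ifs <;> simp
  have hIsum : ∀ (v : ℕ → Ω → U) (k : ℕ) (ω : Ω) (F : U → ℝ),
      ∑ a, I v a k ω * F a = F (r (v k ω)) := by
    intro v k ω F
    simp [I]
  have hloss : ∀ (v : ℕ → Ω → U) (k : ℕ) (ω : Ω),
      lossAt T S ℓ (k:ℤ) (v k) ω = ∑ a, I v a k ω * ℓ a (T^[k] ω) := by
    intro v k ω
    rw [hIsum v k ω (fun a => ℓ a (T^[k] ω)), hr]
    rfl
  have hℓk : ∀ a (k : ℕ), Integrable (fun ω => ℓ a (T^[k] ω)) P := fun a k =>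
    (hTm.iterate k).integrable_comp_of_integrable (hℓi a)
  have hshift : ∀ a (k : ℕ), P[fun ω => ℓ a (T^[k] ω) | obsField T S Y 0 k] =ᵐ[P]
      fun ω => (P[ℓ a | 𝒢 k]) (T^[k] ω) := fun a k => by
    rw [← h𝒢T]
    exact condExp_comp_mp (hTm.iterate k) ((h𝒢Z k).trans hZ0) (hℓi a)
  -- mean optimality
  have hmean : ∀ k : ℕ, 1 ≤ k → ∀ b, ∀ᵐ ω ∂P,
      (P[ℓ (r (ut k ω)) | 𝒢 k]) (T^[k] ω) ≤ (P[ℓ b | 𝒢 k]) (T^[k] ω) + (k:ℝ)⁻¹ := by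
    intro k hk b
    obtain ⟨g, ⟨_, hg, _⟩, hle⟩ := hut.2 k hk
    have h1 := hg (fun _ => b) (show Measurable[obsField T S Y 0 k] _ from measurable_const)
    have h2 : lossAt T S ℓ (k:ℤ) (fun _ => b) = fun ω => ℓ b (T^[k] ω) := rfl
    simp only [h2] at h1
    have hii : ∀ a, Integrable (I ut a k * fun ω => ℓ a (T^[k] ω)) P := fun a => by
      refine (hℓk a k).bdd_mul (c := 1) ((hIm ut hut.1 a k hk).mono (hobs0 k)).aestronglyMeasurable
        (ae_of_all _ fun ω => ?_)
      rw [Real.norm_eq_abs, abs_of_nonneg (hI01 _ _ _ _).1]; exact (hI01 _ _ _ _).2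
    have h3 : lossAt T S ℓ (k:ℤ) (ut k) = ∑ a, I ut a k * fun ω => ℓ a (T^[k] ω) := by
      ext ω
      rw [hloss, Finset.sum_apply]; rfl
    have h4 := condExp_finsetSum (s := Finset.univ) (fun a _ => hii a) (obsField T S Y 0 k)
    rw [← h3] at h4
    have h5 : ∀ᵐ ω ∂P, ∀ a, (P[I ut a k * fun ω => ℓ a (T^[k] ω) | obsField T S Y 0 k]) ω =
        (I ut a k * P[fun ω => ℓ a (T^[k] ω) | obsField T S Y 0 k]) ω := by
      refine ae_all_iff.mpr fun a => ?_
      refine condExp_stronglyMeasurable_mul_of_bound (hobs0 k) (hIm ut hut.1 a k hk) (hℓk a k) 1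
        (ae_of_all _ fun ω => ?_)
      rw [Real.norm_eq_abs, abs_of_nonneg (hI01 _ _ _ _).1]; exact (hI01 _ _ _ _).2
    have h6 : ∀ᵐ ω ∂P, ∀ a, (P[fun ω => ℓ a (T^[k] ω) | obsField T S Y 0 k]) ω =
        (P[ℓ a | 𝒢 k]) (T^[k] ω) := ae_all_iff.mpr fun a => hshift a k
    filter_upwards [h1, hle, h4, h5, h6] with ω e1 e2 e4 e5 e6
    rw [e4, Finset.sum_apply] at e2
    simp only [e5, Pi.mul_apply, e6] at e2
    rw [hIsum ut k ω (fun a => (P[ℓ a | 𝒢 k]) (T^[k] ω))] at e2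
    rw [e6 b] at e1
    linarith
  -- martingale convergence of the conditional losses
  let δ : ℕ → Ω → ℝ := fun k ω => ∑ a, |(P[ℓ a | 𝒢 k]) ω - (P[ℓ a | Z]) ω|
  let D : Ω → ℝ := fun ω => 2 * ∑ a, |(P[ℓ a | Z]) ω|
  let ψ : ℕ → Ω → ℝ := fun k ω => min (2 * δ k ω) (D ω)
  have hcm : ∀ a k, Measurable (P[ℓ a | 𝒢 k]) := fun a k =>
    (stronglyMeasurable_condExp.mono ((h𝒢Z k).trans hZ0)).measurable
  have hcZ : ∀ a, Measurable (P[ℓ a | Z]) := fun a =>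
    (stronglyMeasurable_condExp.mono hZ0).measurable
  have hδ0 : ∀ k ω, 0 ≤ δ k ω := fun k ω => Finset.sum_nonneg fun a _ => abs_nonneg _
  have hD0 : ∀ ω, 0 ≤ D ω := fun ω =>
    mul_nonneg (by norm_num) (Finset.sum_nonneg fun a _ => abs_nonneg _)
  have hδm : ∀ k, Measurable (δ k) := fun k =>
    Finset.measurable_fun_sum _ fun a _ => ((hcm a k).sub (hcZ a)).abs
  have hDm : Measurable D := (Finset.measurable_fun_sum _ fun a _ => (hcZ a).abs).const_mul 2
  have hDi : Integrable D P :=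
    (integrable_finsetSum _ fun a _ => integrable_condExp.abs).const_mul 2
  have hδlim : ∀ᵐ ω ∂P, Tendsto (fun k => δ k ω) atTop (𝓝 0) := by
    let ℱ : Filtration ℕ m0 := ⟨𝒢, fun i j hij => by
      refine iSup₂_le fun k hk => ?_
      exact le_iSup₂_of_le (f := fun k (_ : k ∈ Set.Icc (-(j:ℤ)) 0) =>
        MeasurableSpace.comap (iter T S k) Y) k ⟨by have := hk.1; omega, hk.2⟩ le_rfl,
      fun k => (h𝒢Z k).trans hZ0⟩
    have hsup : ⨆ n, ℱ n = Z := hZdef ▸ iSup_obsField Y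
    have h1 : ∀ᵐ ω ∂P, ∀ a, Tendsto (fun k => (P[ℓ a | 𝒢 k]) ω) atTop (𝓝 ((P[ℓ a | Z]) ω)) := by
      refine ae_all_iff.mpr fun a => ?_
      have := tendsto_ae_condExp (μ := P) (ℱ := ℱ) (ℓ a)
      rw [hsup] at this
      exact this
    filter_upwards [h1] with ω hω
    have := tendsto_finsetSum Finset.univ fun a _ => ((hω a).sub_const ((P[ℓ a | Z]) ω)).abs
    simpa using this
  have hψ : ∀ᵐ ω ∂P, Ces (fun k => ψ k (T^[k] ω)) := by
    refine ces_maker hTm (D := D) (fun k => ((hδm k).const_mul 2).min hDm) hDi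
      (fun k ω => le_min (mul_nonneg (by norm_num) (hδ0 k ω)) (hD0 ω))
      (fun k ω => min_le_right _ _) ?_
    filter_upwards [hδlim] with ω hω
    have h1 : Tendsto (fun k => 2 * δ k ω) atTop (𝓝 0) := by simpa using hω.const_mul 2
    exact squeeze_zero (fun k => le_min (mul_nonneg (by norm_num) (hδ0 k ω)) (hD0 ω))
      (fun k => min_le_left _ _) h1
  -- weights
  let w : U → ℕ → Ω → ℝ := fun a k ω => if 1 ≤ k then I u a k ω - I ut a k ω else 0
  have hw : ∀ᵐ ω ∂P, ∀ a, Ces (fun k => w a k ω * (ℓ a (T^[k] ω) - (P[ℓ a | Z]) (T^[k] ω))) := by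
    refine ae_all_iff.mpr fun a => hgood a (w a) (fun k => ?_) (fun k ω => ?_)
    · by_cases hk : 1 ≤ k
      · simp only [w, hk, if_true]
        exact ((hIm u hu a k hk).sub (hIm ut hut.1 a k hk)).mono (hobsZ k)
      · simp only [w, hk, if_false]
        exact stronglyMeasurable_const
    · simp only [w]
      split_ifs
      · have h1 := hI01 u a k ω
        have h2 := hI01 ut a k ω
        rw [abs_le]; constructor <;> linarith
      · simp
  have hmean' : ∀ᵐ ω ∂P, ∀ k : ℕ, 1 ≤ k → ∀ b,
      (P[ℓ (r (ut k ω)) | 𝒢 k]) (T^[k] ω) ≤ (P[ℓ b | 𝒢 k]) (T^[k] ω) + (k:ℝ)⁻¹ := by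
    refine ae_all_iff.mpr fun k => ?_
    by_cases hk : 1 ≤ k
    · filter_upwards [ae_all_iff.mpr (hmean k hk)] with ω hω _ using hω
    · exact ae_of_all _ fun ω h => absurd h hk
  filter_upwards [hψ, hw, hmean'] with ω h1 h2 h3
  have hinv : Ces (fun k : ℕ => (k:ℝ)⁻¹) := ces_of_tendsto tendsto_inv_atTop_nhds_zero_nat
  have hc := ((Ces.sum Finset.univ fun a _ => h2 a).add (ces_neg h1)).add (ces_neg hinv)
  have hfin := liminf_nonneg_of_ces
    (d := fun k => lossAt T S ℓ (k:ℤ) (u k) ω - lossAt T S ℓ (k:ℤ) (ut k) ω) hc ?_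
  · simpa only [avgLoss, Finset.sum_sub_distrib, mul_sub] using hfin
  · intro k hk
    set x := T^[k] ω
    have e1 : ∑ a, w a k ω * (ℓ a x - (P[ℓ a | Z]) x) =
        (ℓ (r (u k ω)) x - (P[ℓ (r (u k ω)) | Z]) x) -
        (ℓ (r (ut k ω)) x - (P[ℓ (r (ut k ω)) | Z]) x) := by
      simp only [w, hk, if_true, sub_mul (I u _ k ω), Finset.sum_sub_distrib]
      rw [hIsum u k ω (fun a => ℓ a x - (P[ℓ a | Z]) x),
        hIsum ut k ω (fun a => ℓ a x - (P[ℓ a | Z]) x)]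
    have e2 : ∀ v : ℕ → Ω → U, lossAt T S ℓ (k:ℤ) (v k) ω = ℓ (r (v k ω)) x := fun v => by
      rw [hloss, hIsum v k ω (fun a => ℓ a (T^[k] ω))]
    rw [e1, e2 u, e2 ut]
    set i := r (u k ω)
    set j := r (ut k ω)
    have h4 := h3 k hk i
    have hd : ∀ a, |(P[ℓ a | 𝒢 k]) x - (P[ℓ a | Z]) x| ≤ δ k x := fun a =>
      Finset.single_le_sum (f := fun a => |(P[ℓ a | 𝒢 k]) x - (P[ℓ a | Z]) x|)
        (fun a _ => abs_nonneg _) (Finset.mem_univ a)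
    have hd2 : ∀ a, |(P[ℓ a | Z]) x| ≤ ∑ a, |(P[ℓ a | Z]) x| := fun a =>
      Finset.single_le_sum (f := fun a => |(P[ℓ a | Z]) x|)
        (fun a _ => abs_nonneg _) (Finset.mem_univ a)
    have hkpos : (0:ℝ) ≤ (k:ℝ)⁻¹ := by positivity
    have h5 : (P[ℓ j | Z]) x - (P[ℓ i | Z]) x - (k:ℝ)⁻¹ ≤ ψ k x := by
      refine le_min ?_ ?_
      · have a1 := abs_le.mp (hd i)
        have a2 := abs_le.mp (hd j)
        linarith [a1.1, a1.2, a2.1, a2.2]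
      · have a1 := abs_le.mp (hd2 i)
        have a2 := abs_le.mp (hd2 j)
        change _ ≤ 2 * ∑ a, |(P[ℓ a | Z]) x|
        linarith [a1.1, a1.2, a2.1, a2.2]
    linarith


lemma final_aux {Ω U : Type*} {X Y : MeasurableSpace Ω} [m0 : MeasurableSpace Ω]
    [MeasurableSpace U] [Finite U]
    (P : Measure Ω) [IsProbabilityMeasure P]
    (T S : Ω → Ω) (hT : Ergodic T P) (hS : MeasurePreserving S P P)
    (hST : Function.LeftInverse S T) (hTS : Function.RightInverse S T)
    (ℓ : U → Ω → ℝ) (hℓ : Measurable fun p : U × Ω => ℓ p.1 p.2)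
    (Λ : Ω → ℝ) (hΛ : Integrable Λ P) (hdom : ∀ u ω, |ℓ u ω| ≤ Λ ω)
    (hY : Y ≤ m0) (hX0 : X ≤ m0) (hXT : X ≤ MeasurableSpace.comap T X)
    (hgen : EqModP P (⨆ k : ℕ, MeasurableSpace.comap (T^[k + 1]) X) m0)
    (htail : EqModP P (⨅ k : ℕ, obsFieldLE T S Y 0 ⊔ MeasurableSpace.comap (S^[k + 1]) X)
      (obsFieldLE T S Y 0))
    (ut : ℕ → Ω → U) (hut : MeanOptimalStrategy P T S Y ℓ ut) :
    PathwiseOptimal P T S Y ℓ ut := by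
  have hZ0 : obsFieldLE T S Y 0 ≤ m0 := obsFieldLE_le hT.measurable hS.measurable hY
  have hℓm : ∀ a, Measurable (ℓ a) := fun a => hℓ.comp (measurable_const.prodMk measurable_id)
  have hℓi : ∀ a, Integrable (ℓ a) P := fun a =>
    hΛ.mono' (hℓm a).aestronglyMeasurable (ae_of_all _ fun ω => hdom a ω)
  exact main_aux P T S hT.toMeasurePreserving hST hTS ℓ hℓ hℓi rfl hZ0
    (fun a => hgood_aux hT.toMeasurePreserving hS hST hTS hZ0
      (obsFieldLE_shift hST hTS Y) hX0 hXT hgen htail (hℓi a)) ut hut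

/-- Theorem 1.5: if the decision space `U` is finite and the system is a
conditional K-automorphism relative to `𝒴_{-∞,0}`, then every mean-optimal strategy is
pathwise optimal. -/
theorem statement0
    {Ω U : Type*} [m0 : MeasurableSpace Ω] [MeasurableSpace U] [Finite U]
    (P : Measure Ω) [IsProbabilityMeasure P]
    (T S : Ω → Ω) (hT : Ergodic T P) (hS : MeasurePreserving S P P)
    (hST : Function.LeftInverse S T) (hTS : Function.RightInverse S T)
    (ℓ : U → Ω → ℝ) (hℓ : Measurable fun p : U × Ω => ℓ p.1 p.2)
    (Λ : Ω → ℝ) (hΛ : Integrable Λ P) (hdom : ∀ u ω, |ℓ u ω| ≤ Λ ω)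
    (Y : MeasurableSpace Ω) (hY : Y ≤ m0)
    (hK : CondK P T S (obsFieldLE T S Y 0))
    (ut : ℕ → Ω → U) (hut : MeanOptimalStrategy P T S Y ℓ ut) :
    PathwiseOptimal P T S Y ℓ ut := by
  obtain ⟨X, hX0, hXT, hgen, htail⟩ := hK
  exact @final_aux Ω U X Y m0 _ _ P _ T S hT hS hST hTS ℓ hℓ Λ hΛ hdom hY hX0 hXT hgen htail ut hut

end ErgodicDecisions
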